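/- Let θ ≥ 0, p > 0, q > 0 and d ≥ 1 be real numbers, let T₁ > 0 satisfy √T₁ ≥ 3·max(p,q)·b₁·√d, and let (b_i)_{i≥1} be a real sequence with b₁ ≥ 1 and b_{i+1} ≤ θ + (i·(p·b_i + q·√d))/(2^{(i−1)/2}·√T₁) for all i ≥ 1. Then b_i ≤ 2θ + 2 for every i ≥ 2. -/

import Mathlib

theorem eight_mul_sq_le_nine_mul_two_pow (i : ℕ) : 8 * i ^ 2 ≤ 9 * 2 ^ i := by
  rcases Nat.lt_or_ge i 3 with h | h
  · interval_cases i <;> norm_num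
  · induction i, h using Nat.le_induction with
    | base => norm_num
    | succ n hn ih =>
      rw [pow_succ 2 n]
      nlinarith

theorem natCast_le_three_halves_mul_two_rpow (i : ℕ) :
    (i : ℝ) ≤ 3 / 2 * (2 : ℝ) ^ (((i : ℝ) - 1) / 2) := by
  have hsq : ((2 : ℝ) ^ (((i : ℝ) - 1) / 2)) ^ 2 = 2 ^ i / 2 := by
    rw [← Real.rpow_natCast, ← Real.rpow_mul (by norm_num)]
    push_cast
    rw [div_mul_cancel₀ _ (by norm_num), Real.rpow_sub_one (by norm_num), Real.rpow_natCast]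
  have h : (8 : ℝ) * i ^ 2 ≤ 9 * 2 ^ i := by
    exact_mod_cast eight_mul_sq_le_nine_mul_two_pow i
  refine (sq_le_sq₀ (by positivity) (by positivity)).1 ?_
  rw [mul_pow, hsq]
  linarith

theorem natCast_mul_div_two_rpow_mul_le {i : ℕ} {N S K : ℝ} (hS : 0 < S) (hK : 0 ≤ K)
    (hN : N ≤ S * K) :
    (i * N) / ((2 : ℝ) ^ (((i : ℝ) - 1) / 2) * S) ≤ 3 / 2 * K := by
  rw [div_le_iff₀ (by positivity)]
  calc (i : ℝ) * N ≤ i * (S * K) := by gcongr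
    _ ≤ (3 / 2 * (2 : ℝ) ^ (((i : ℝ) - 1) / 2)) * (S * K) := by
      gcongr
      exact natCast_le_three_halves_mul_two_rpow i
    _ = _ := by ring


/-- Uniform upper bound `b_i ≤ 2θ + 2` on the norm estimates of ALB-Norm. -/
theorem stmt_2 (θ p q d : ℝ) (hθ : 0 ≤ θ) (hp : 0 < p) (hq : 0 < q) (hd : 1 ≤ d)
    (T₁ : ℝ) (hT₁ : 0 < T₁) (b : ℕ → ℝ) (hb1 : 1 ≤ b 1)
    (hT : 3 * max p q * b 1 * Real.sqrt d ≤ Real.sqrt T₁)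
    (hrec : ∀ i : ℕ, 1 ≤ i →
      b (i + 1) ≤ θ + (i * (p * b i + q * Real.sqrt d)) /
        ((2 : ℝ) ^ (((i : ℝ) - 1) / 2) * Real.sqrt T₁)) :
    ∀ i : ℕ, 2 ≤ i → b i ≤ 2 * θ + 2 := by
  have hS : 0 < Real.sqrt T₁ := Real.sqrt_pos.2 hT₁
  have hs : 1 ≤ Real.sqrt d := Real.one_le_sqrt.2 hd
  have hm : 0 < max p q := lt_max_of_lt_left hp
  have hpb : 3 * (p * b 1) ≤ Real.sqrt T₁ := by
    have h1 : p * b 1 ≤ max p q * b 1 := by gcongr; exact le_max_left p q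
    have h2 : max p q * b 1 ≤ max p q * b 1 * Real.sqrt d :=
      le_mul_of_one_le_right (by positivity) hs
    linarith
  have hp3 : 3 * p ≤ Real.sqrt T₁ := by
    have := le_mul_of_one_le_right hp.le hb1
    linarith
  have hqs : 3 * (q * Real.sqrt d) ≤ Real.sqrt T₁ := by
    have h1 : q * Real.sqrt d ≤ max p q * Real.sqrt d := by gcongr; exact le_max_right p q
    have h2 : max p q * Real.sqrt d ≤ max p q * Real.sqrt d * b 1 :=
      le_mul_of_one_le_right (by positivity) hb1
    linarith
  intro i hi
  induction i, hi using Nat.le_induction with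
  | base =>
    have h := natCast_mul_div_two_rpow_mul_le (i := 1) (K := 2 / 3) hS (by norm_num)
      (show p * b 1 + q * Real.sqrt d ≤ Real.sqrt T₁ * (2 / 3) by linarith)
    have := hrec 1 le_rfl
    norm_num only at this h ⊢
    linarith
  | succ n hn ih =>
    have hN : p * b n + q * Real.sqrt d ≤ Real.sqrt T₁ * ((2 * θ + 3) / 3) := by
      have h1 : p * b n ≤ p * (2 * θ + 2) := by gcongr
      have h2 : 3 * p * (2 * θ + 2) ≤ Real.sqrt T₁ * (2 * θ + 2) := by gcongr
      linarith
    have h := natCast_mul_div_two_rpow_mul_le (i := n) hS (by positivity) hN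
    have := hrec n (by omega)
    linarith
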